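/- Let ρ₀ ∈ [0, 1), β > 0, γ > 0, and define ρ(P) = ρ₀ + β(P − 1)^γ and g(P) = (1 − ρ(P))/P + ρ(P) for real P > 1. Then there exists P₀ > 1 such that g′(P) > 0 for all P ≥ P₀; in particular, g is strictly increasing on [P₀, ∞). -/

import Mathlib

/-- Rising correlation model: ρ(P) = ρ₀ + β(P − 1)^γ (real exponent). -/
noncomputable def rhoFun (ρ₀ β γ P : ℝ) : ℝ := ρ₀ + β * (P - 1) ^ γ

/-- Unnormalized variance factor: g(P) = (1 − ρ(P))/P + ρ(P). -/
noncomputable def gFun (ρ₀ β γ P : ℝ) : ℝ :=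
  (1 - rhoFun ρ₀ β γ P) / P + rhoFun ρ₀ β γ P

/-- g′(P) = ρ′(P)(1 − 1/P) − (1 − ρ(P))/P² with ρ′(P) = βγ(P − 1)^{γ−1}. -/
noncomputable def gDeriv (ρ₀ β γ P : ℝ) : ℝ :=
  β * γ * (P - 1) ^ (γ - 1) * (1 - 1 / P) - (1 - rhoFun ρ₀ β γ P) / P ^ 2

theorem hasDerivAt_rhoFun (ρ₀ β γ : ℝ) {P : ℝ} (hP : 1 < P) :
    HasDerivAt (rhoFun ρ₀ β γ) (β * γ * (P - 1) ^ (γ - 1)) P := by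
  have h := ((((hasDerivAt_id P).sub_const 1).rpow_const (p := γ)
    (Or.inl (sub_pos.2 hP).ne')).const_mul β).const_add ρ₀
  refine h.congr_deriv ?_
  rw [id_eq]
  ring

theorem hasDerivAt_gFun (ρ₀ β γ : ℝ) {P : ℝ} (hP : 1 < P) :
    HasDerivAt (gFun ρ₀ β γ) (gDeriv ρ₀ β γ P) P := by
  have hP0 : P ≠ 0 := (zero_lt_one.trans hP).ne'
  have hρ := hasDerivAt_rhoFun ρ₀ β γ hP
  have h := ((hρ.const_sub 1).div (hasDerivAt_id P) hP0).add hρ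
  refine h.congr_deriv ?_
  simp only [gDeriv, id_eq]
  field_simp
  ring

theorem gDeriv_pos {ρ₀ β γ P : ℝ} (hβ : 0 < β) (hγ : 0 < γ) (hP : 1 < P)
    (hρ : 1 ≤ rhoFun ρ₀ β γ P) : 0 < gDeriv ρ₀ β γ P := by
  have h₁ : 0 < (P - 1) ^ (γ - 1) := Real.rpow_pos_of_pos (sub_pos.2 hP) _
  have h₂ : 0 < 1 - 1 / P := sub_pos.2 ((div_lt_one (zero_lt_one.trans hP)).2 hP)
  have h₃ : (1 - rhoFun ρ₀ β γ P) / P ^ 2 ≤ 0 :=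
    div_nonpos_of_nonpos_of_nonneg (by linarith) (sq_nonneg P)
  have h₄ : 0 < β * γ * (P - 1) ^ (γ - 1) * (1 - 1 / P) := by positivity
  unfold gDeriv
  linarith

theorem tendsto_rhoFun_atTop (ρ₀ : ℝ) {β γ : ℝ} (hβ : 0 < β) (hγ : 0 < γ) :
    Filter.Tendsto (rhoFun ρ₀ β γ) Filter.atTop Filter.atTop :=
  Filter.tendsto_atTop_add_const_left _ _ <|
    ((tendsto_rpow_atTop hγ).comp
      (Filter.tendsto_atTop_add_const_right _ (-1) Filter.tendsto_id)).const_mul_atTop hβ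

/-- **For large P the variance factor increases:** there is P₀ > 1 with g′(P) > 0 for all
P ≥ P₀; in particular g is strictly increasing on [P₀, ∞). -/
theorem gFun_increasing_eventually (ρ₀ β γ : ℝ) (hρ₀ : ρ₀ ∈ Set.Ico (0 : ℝ) 1)
    (hβ : 0 < β) (hγ : 0 < γ) :
    ∃ P₀ : ℝ, 1 < P₀ ∧ (∀ P ≥ P₀, 0 < gDeriv ρ₀ β γ P) ∧
      StrictMonoOn (gFun ρ₀ β γ) (Set.Ici P₀) := by
  obtain ⟨P₁, hP₁⟩ := Filter.eventually_atTop.1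
    ((tendsto_rhoFun_atTop ρ₀ hβ hγ).eventually_ge_atTop 1)
  have hlt : 1 < max 2 P₁ := one_lt_two.trans_le (le_max_left _ _)
  have hpos : ∀ P ≥ max 2 P₁, 0 < gDeriv ρ₀ β γ P := fun P hP =>
    gDeriv_pos hβ hγ (hlt.trans_le hP) (hP₁ P ((le_max_right _ _).trans hP))
  refine ⟨max 2 P₁, hlt, hpos, strictMonoOn_of_deriv_pos (convex_Ici _) ?_ ?_⟩
  · exact fun P hP => (hasDerivAt_gFun ρ₀ β γ (hlt.trans_le hP)).continuousAt.continuousWithinAt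
  · intro P hP
    have hP' : max 2 P₁ ≤ P := interior_subset hP
    rw [(hasDerivAt_gFun ρ₀ β γ (hlt.trans_le hP')).deriv]
    exact hpos P hP'
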